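/- arXiv:1204.4355 — 2 statements merged into one kernel-verified Lean document; each statement's English description precedes it below -/
import Mathlib

section
/- The polynomial Y^2 + (X^2+X)Y + (X^5+X^3+a^2 X^2+a^2 X) in the variable Y, where a is a generator of the multiplicative group of F_4 (so a^2 = a+1), with coefficients in the rational function field F_4(X), is irreducible over F_4(X). (Hence it defines the genus-2 function field over F_4 used as base for the record curve of genus 41 with 72 points over F_4.) -/
open Polynomial

/-- `x` denotes the generator `X` of the rational function field `F₄(X)`. -/
noncomputable def x : RatFunc (GaloisField 2 2) := RatFunc.X

/-- A quadratic `Y² + bY + c` over `k[X]` is irreducible when `X` divides `b` and `c` has a simple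
zero at the origin (Eisenstein's criterion at `X`). -/
theorem irreducible_quadratic_of_X_dvd {k : Type*} [Field k] {b c : k[X]} (hb : X ∣ b)
    (hc : X ∣ c) (hc' : ¬ X ^ 2 ∣ c) :
    Irreducible (X ^ 2 + C b * X + C c : k[X][X]) := by
  have hdeg : (X ^ 2 + C b * X + C c : k[X][X]).natDegree = 2 := by compute_degree!
  have hmonic : (X ^ 2 + C b * X + C c : k[X][X]).Monic := by monicity!
  have hprime : (Ideal.span {(X : k[X])}).IsPrime :=
    (Ideal.span_singleton_prime X_ne_zero).2 prime_X
  refine IsEisensteinAt.irreducible (𝓟 := Ideal.span {(X : k[X])}) ⟨?_, ?_, ?_⟩ hprime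
    hmonic.isPrimitive (by omega)
  · rw [hmonic.leadingCoeff]
    exact fun h => hprime.ne_top ((Ideal.eq_top_iff_one _).2 h)
  · intro n hn
    rw [hdeg] at hn
    rw [Ideal.mem_span_singleton]
    interval_cases n
    · simpa using hc
    · simpa [coeff_X, coeff_C] using hb
  · rw [Ideal.span_singleton_pow, Ideal.mem_span_singleton]
    simpa using hc'

/-- For `a` a primitive element of `F₄`, i.e. a generator of the multiplicative group `F₄ˣ`
(equivalently, `a² = a + 1`), the polynomial `Y² + (X²+X)Y + (X⁵+X³+a²X²+a²X)` is
irreducible over `F₄(X)`. -/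
theorem stmt_13 (a : GaloisField 2 2) (ha : a ^ 2 = a + 1) :
    Irreducible (X ^ 2 + C (x ^ 2 + x) * X +
      C (x ^ 5 + x ^ 3 + RatFunc.C (a ^ 2) * x ^ 2 + RatFunc.C (a ^ 2) * x)) := by
  have ha0 : a ^ 2 ≠ 0 := by
    intro h
    have h0 : a = 0 := by simpa using h
    simp [h0] at ha
  set b : (GaloisField 2 2)[X] := X ^ 2 + X with hb
  set c : (GaloisField 2 2)[X] := X ^ 5 + X ^ 3 + C (a ^ 2) * X ^ 2 + C (a ^ 2) * X with hc
  have hirr : Irreducible (X ^ 2 + C b * X + C c : (GaloisField 2 2)[X][X]) := by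
    refine irreducible_quadratic_of_X_dvd ⟨X + 1, by rw [hb]; ring⟩
      ⟨X ^ 4 + X ^ 2 + C (a ^ 2) * X + C (a ^ 2), by rw [hc]; ring⟩ fun h => ha0 ?_
    have h1 := X_pow_dvd_iff.1 h 1 one_lt_two
    simpa [hc, coeff_X, coeff_X_pow, -map_pow] using h1
  have hmonic : (X ^ 2 + C b * X + C c : (GaloisField 2 2)[X][X]).Monic := by monicity!
  have hmap := (hmonic.irreducible_iff_irreducible_map_fraction_map
    (K := RatFunc (GaloisField 2 2))).1 hirr
  simpa [hb, hc, x, RatFunc.algebraMap_X, RatFunc.algebraMap_C] using hmap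
end

section
/- Let K = F_5(z)[y]/(y^2 + 4z^6+2z^5+2z^3+z^2+2z) be the quadratic function field over F_5(z) obtained by adjoining a root y of the irreducible polynomial Y^2 + (4z^6+2z^5+2z^3+z^2+2z). Then the polynomial T^3 + ((4z+3)y + 3z^4+3z^2+2)T + (4z^3+3z^2+4z+2)y + 4z^6+z^4+z^3+z^2+2z+2, in the variable T with coefficients in K, is irreducible over K. (This cubic defines the record curve of genus 8 with 24 rational points over F_5.) -/
open Polynomial

instance : Fact (Nat.Prime 5) := ⟨by norm_num⟩

/-- `z` denotes the generator `Z` of the rational function field `F₅(z)`. -/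
noncomputable def z : RatFunc (ZMod 5) := RatFunc.X

/-- The defining polynomial `Y² + (4z⁶+2z⁵+2z³+z²+2z)` of the genus-2 base field over `F₅`. -/
noncomputable def p : Polynomial (RatFunc (ZMod 5)) :=
  X ^ 2 + C (4 * z ^ 6 + 2 * z ^ 5 + 2 * z ^ 3 + z ^ 2 + 2 * z)

/-- The image of `z` in `K = F₅(z)[y]/(p)`. -/
noncomputable def zK : AdjoinRoot p := AdjoinRoot.of p z

/-- The adjoined root `y` in `K = F₅(z)[y]/(p)`. -/
noncomputable def y : AdjoinRoot p := AdjoinRoot.root p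

/-- The embedding of `F₅[z]` into `K`. -/
noncomputable def polyToK : (ZMod 5)[X] →+* AdjoinRoot p :=
  (AdjoinRoot.of p).comp (algebraMap (ZMod 5)[X] (RatFunc (ZMod 5)))

lemma polyToK_X : polyToK X = zK := by
  simp [polyToK, zK, z]

lemma p_monic : p.Monic := by
  unfold p
  monicity!

lemma p_natDegree : p.natDegree = 2 := by
  unfold p
  compute_degree!

lemma y_sq : y ^ 2 = zK ^ 6 - 2 * zK ^ 5 - 2 * zK ^ 3 - zK ^ 2 - 2 * zK := by
  have h : AdjoinRoot.mk p p = 0 := AdjoinRoot.mk_self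
  conv_lhs at h => arg 2; unfold p
  simp only [map_add, map_pow, map_mul, AdjoinRoot.mk_X, AdjoinRoot.mk_C, map_ofNat] at h
  change y ^ 2 + (4 * zK ^ 6 + 2 * zK ^ 5 + 2 * zK ^ 3 + zK ^ 2 + 2 * zK) = 0 at h
  have h5 : (5 : AdjoinRoot p) = 0 := by
    have := congrArg polyToK (CharP.cast_eq_zero (ZMod 5)[X] 5)
    rwa [map_natCast, map_zero] at this
  linear_combination h - zK ^ 6 * h5

lemma eq_zero_of_polyToK_add_mul_y {a b : (ZMod 5)[X]}
    (h : polyToK a + polyToK b * y = 0) : a = 0 ∧ b = 0 := by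
  set a' := algebraMap (ZMod 5)[X] (RatFunc (ZMod 5)) a with ha
  set b' := algebraMap (ZMod 5)[X] (RatFunc (ZMod 5)) b with hb
  have hmk : AdjoinRoot.mk p (C b' * X + C a') = 0 := by
    rw [← h, map_add, map_mul, AdjoinRoot.mk_X, AdjoinRoot.mk_C, AdjoinRoot.mk_C, add_comm]
    rfl
  rw [AdjoinRoot.mk_eq_zero] at hmk
  have hzero : C b' * X + C a' = 0 := by
    refine eq_zero_of_dvd_of_natDegree_lt hmk ?_
    rw [p_natDegree]
    exact natDegree_linear_le.trans_lt one_lt_two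
  have h0 : a' = 0 := by simpa using congrArg (coeff · 0) hzero
  have h1 : b' = 0 := by simpa using congrArg (coeff · 1) hzero
  exact ⟨by simpa [ha] using h0, by simpa [hb] using h1⟩

lemma exists_polyToK_mul_eq (t : AdjoinRoot p) :
    ∃ a b d : (ZMod 5)[X], d ≠ 0 ∧ polyToK d * t = polyToK a + polyToK b * y := by
  obtain ⟨g, rfl⟩ := AdjoinRoot.mk_surjective t
  have hdeg : (g %ₘ p).natDegree ≤ 1 := by
    have := natDegree_modByMonic_lt g p_monic fun h => by simpa [h] using p_natDegree
    rw [p_natDegree] at this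
    omega
  have hg : AdjoinRoot.mk p g = AdjoinRoot.mk p (g %ₘ p) := by
    rw [AdjoinRoot.mk_eq_mk]
    exact ⟨g /ₘ p, by linear_combination -modByMonic_add_div g p⟩
  obtain ⟨u, v, huv⟩ := exists_eq_X_add_C_of_natDegree_le_one hdeg
  refine ⟨u.denom * v.num, v.denom * u.num, u.denom * v.denom,
    mul_ne_zero u.denom_ne_zero v.denom_ne_zero, ?_⟩
  have hu : algebraMap (ZMod 5)[X] (RatFunc (ZMod 5)) u.denom * u = algebraMap _ _ u.num := by
    have := RatFunc.num_div_denom u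
    rw [div_eq_iff (RatFunc.algebraMap_ne_zero u.denom_ne_zero)] at this
    rw [this, mul_comm]
  have hv : algebraMap (ZMod 5)[X] (RatFunc (ZMod 5)) v.denom * v = algebraMap _ _ v.num := by
    have := RatFunc.num_div_denom v
    rw [div_eq_iff (RatFunc.algebraMap_ne_zero v.denom_ne_zero)] at this
    rw [this, mul_comm]
  rw [hg, huv]
  simp only [map_add, AdjoinRoot.mk_X, AdjoinRoot.mk_C, polyToK, RingHom.comp_apply, map_mul, ← hu, ← hv, y]
  ring

/-- The constant coordinate, in the basis `1, y`, of the homogenized cubic at `(a + b y, d)`. -/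
def cubicCoordOne {R : Type*} [CommRing R] (x a b d : R) : R :=
  a ^ 3 + 3 * a * b ^ 2 * (x ^ 6 - 2 * x ^ 5 - 2 * x ^ 3 - x ^ 2 - 2 * x) +
    d ^ 2 * ((3 * x ^ 4 + 3 * x ^ 2 + 2) * a +
      (4 * x + 3) * b * (x ^ 6 - 2 * x ^ 5 - 2 * x ^ 3 - x ^ 2 - 2 * x)) +
    d ^ 3 * (4 * x ^ 6 + x ^ 4 + x ^ 3 + x ^ 2 + 2 * x + 2)

/-- The `y`-coordinate, in the basis `1, y`, of the homogenized cubic at `(a + b y, d)`. -/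
def cubicCoordY {R : Type*} [CommRing R] (x a b d : R) : R :=
  3 * a ^ 2 * b + b ^ 3 * (x ^ 6 - 2 * x ^ 5 - 2 * x ^ 3 - x ^ 2 - 2 * x) +
    d ^ 2 * ((3 * x ^ 4 + 3 * x ^ 2 + 2) * b + (4 * x + 3) * a) +
    d ^ 3 * (4 * x ^ 3 + 3 * x ^ 2 + 4 * x + 2)

lemma map_cubicCoordOne {R S : Type*} [CommRing R] [CommRing S] (f : R →+* S) (x a b d : R) :
    f (cubicCoordOne x a b d) = cubicCoordOne (f x) (f a) (f b) (f d) := by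
  simp only [cubicCoordOne, map_add, map_sub, map_mul, map_pow, map_ofNat]

lemma map_cubicCoordY {R S : Type*} [CommRing R] [CommRing S] (f : R →+* S) (x a b d : R) :
    f (cubicCoordY x a b d) = cubicCoordY (f x) (f a) (f b) (f d) := by
  simp only [cubicCoordY, map_add, map_sub, map_mul, map_pow, map_ofNat]

lemma cubicCoordOne_mul {R : Type*} [CommRing R] (c x a b d : R) :
    cubicCoordOne x (c * a) (c * b) (c * d) = c ^ 3 * cubicCoordOne x a b d := by
  unfold cubicCoordOne
  ring

lemma cubicCoordY_mul {R : Type*} [CommRing R] (c x a b d : R) :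
    cubicCoordY x (c * a) (c * b) (c * d) = c ^ 3 * cubicCoordY x a b d := by
  unfold cubicCoordY
  ring

/-- Both places of `K` above `z = 2` are inert in the cubic extension. -/
lemma eq_zero_of_cubicCoord_two : ∀ a b d : ZMod 5, cubicCoordOne 2 a b d = 0 →
    cubicCoordY 2 a b d = 0 → a = 0 ∧ b = 0 ∧ d = 0 := by
  unfold cubicCoordOne cubicCoordY
  decide

lemma pow_dvd_of_cubicCoord_eq_zero (n : ℕ) : ∀ a b d : (ZMod 5)[X],
    cubicCoordOne X a b d = 0 → cubicCoordY X a b d = 0 → (X - C 2) ^ n ∣ d := by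
  induction n with
  | zero => simp
  | succ n ih =>
    intro a b d h₁ h₂
    have e₁ := congrArg (evalRingHom 2) h₁
    have e₂ := congrArg (evalRingHom 2) h₂
    rw [map_cubicCoordOne, map_zero] at e₁
    rw [map_cubicCoordY, map_zero] at e₂
    simp only [coe_evalRingHom, eval_X] at e₁ e₂
    obtain ⟨ha, hb, hd⟩ := eq_zero_of_cubicCoord_two _ _ _ e₁ e₂
    obtain ⟨a, rfl⟩ := dvd_iff_isRoot.2 ha
    obtain ⟨b, rfl⟩ := dvd_iff_isRoot.2 hb
    obtain ⟨d, rfl⟩ := dvd_iff_isRoot.2 hd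
    have hc : (X - C 2 : (ZMod 5)[X]) ^ 3 ≠ 0 := pow_ne_zero _ (X_sub_C_ne_zero 2)
    rw [cubicCoordOne_mul, mul_eq_zero_iff_left hc] at h₁
    rw [cubicCoordY_mul, mul_eq_zero_iff_left hc] at h₂
    rw [pow_succ']
    exact mul_dvd_mul_left _ (ih a b d h₁ h₂)

lemma eq_zero_of_cubicCoord_eq_zero {a b d : (ZMod 5)[X]}
    (h₁ : cubicCoordOne X a b d = 0) (h₂ : cubicCoordY X a b d = 0) : d = 0 := by
  refine eq_zero_of_dvd_of_natDegree_lt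
    (pow_dvd_of_cubicCoord_eq_zero (d.natDegree + 1) a b d h₁ h₂) ?_
  simp [natDegree_pow]

lemma cubic_ne_zero (t : AdjoinRoot p) :
    t ^ 3 + ((4 * zK + 3) * y + 3 * zK ^ 4 + 3 * zK ^ 2 + 2) * t +
      ((4 * zK ^ 3 + 3 * zK ^ 2 + 4 * zK + 2) * y +
        4 * zK ^ 6 + zK ^ 4 + zK ^ 3 + zK ^ 2 + 2 * zK + 2) ≠ 0 := by
  intro ht
  obtain ⟨a, b, d, hd, h⟩ := exists_polyToK_mul_eq t
  refine hd (?_ : d = 0)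
  have key : polyToK (cubicCoordOne X a b d) + polyToK (cubicCoordY X a b d) * y = 0 := by
    rw [map_cubicCoordOne, map_cubicCoordY, polyToK_X]
    generalize polyToK a = a at *
    generalize polyToK b = b at *
    generalize polyToK d = d at *
    obtain rfl : a = d * t - b * y := by linear_combination -h
    unfold cubicCoordOne cubicCoordY
    rw [← y_sq]
    linear_combination d ^ 3 * ht
  obtain ⟨h₁, h₂⟩ := eq_zero_of_polyToK_add_mul_y key
  exact eq_zero_of_cubicCoord_eq_zero h₁ h₂

/-- Assuming `p` is irreducible (so that `K = AdjoinRoot p` is the quadratic function field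
`F₅(z)(y)`), the polynomial
`T³ + ((4z+3)y + 3z⁴+3z²+2)T + (4z³+3z²+4z+2)y + 4z⁶+z⁴+z³+z²+2z+2`
is irreducible over `K`. -/
theorem stmt_15 [Fact (Irreducible p)] :
    Irreducible (X ^ 3 +
      C ((4 * zK + 3) * y + 3 * zK ^ 4 + 3 * zK ^ 2 + 2) * X +
      C ((4 * zK ^ 3 + 3 * zK ^ 2 + 4 * zK + 2) * y +
        4 * zK ^ 6 + zK ^ 4 + zK ^ 3 + zK ^ 2 + 2 * zK + 2)) := by
  generalize hA : (4 * zK + 3) * y + 3 * zK ^ 4 + 3 * zK ^ 2 + 2 = A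
  generalize hB : (4 * zK ^ 3 + 3 * zK ^ 2 + 4 * zK + 2) * y +
    4 * zK ^ 6 + zK ^ 4 + zK ^ 3 + zK ^ 2 + 2 * zK + 2 = B
  have hdeg : (X ^ 3 + C A * X + C B).natDegree = 3 := by compute_degree!
  rw [irreducible_iff_roots_eq_zero_of_degree_le_three (by omega) (by omega),
    Multiset.eq_zero_iff_forall_notMem]
  intro t ht
  apply cubic_ne_zero t
  rw [hA, hB]
  simpa using (mem_roots'.1 ht).2
end
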